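/- For each fixed t ∈ ℝ, the inverse matrix F(x,t)⁻¹ tends to the zero matrix as x → +∞ and as x → −∞. -/

import Mathlib

open Matrix MeasureTheory Filter

noncomputable def mexp {p : ℕ} (M : Matrix (Fin p) (Fin p) ℝ) : Matrix (Fin p) (Fin p) ℝ :=
  ∑' k : ℕ, (k.factorial : ℝ)⁻¹ • M ^ k

def EigPos {p : ℕ} (A : Matrix (Fin p) (Fin p) ℝ) : Prop :=
  ∀ μ ∈ spectrum ℂ (A.map Complex.ofReal), 0 < μ.re

def Observable {p : ℕ} (A : Matrix (Fin p) (Fin p) ℝ) (C : Matrix (Fin 1) (Fin p) ℝ) : Prop :=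
  ∀ v : Fin p → ℝ, (∀ r : ℕ, (C * A ^ r) *ᵥ v = 0) → v = 0

def Controllable {p : ℕ} (A : Matrix (Fin p) (Fin p) ℝ) (B : Matrix (Fin p) (Fin 1) ℝ) : Prop :=
  ∀ v : Fin p → ℝ, (∀ r : ℕ, (Bᵀ * Aᵀ ^ r) *ᵥ v = 0) → v = 0

noncomputable def Qmat {p : ℕ} (A : Matrix (Fin p) (Fin p) ℝ) (C : Matrix (Fin 1) (Fin p) ℝ) :
    Matrix (Fin p) (Fin p) ℝ :=
  Matrix.of fun i j =>
    ∫ s in Set.Ioi (0 : ℝ), (mexp (-(s • Aᵀ)) * (Cᵀ * C) * mexp (-(s • A))) i j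

noncomputable def Nmat {p : ℕ} (A : Matrix (Fin p) (Fin p) ℝ) (B : Matrix (Fin p) (Fin 1) ℝ) :
    Matrix (Fin p) (Fin p) ℝ :=
  Matrix.of fun i j =>
    ∫ s in Set.Ioi (0 : ℝ), (mexp (-(s • A)) * (B * Bᵀ) * mexp (-(s • Aᵀ))) i j

noncomputable def Pmat {p : ℕ} (A : Matrix (Fin p) (Fin p) ℝ) (B : Matrix (Fin p) (Fin 1) ℝ)
    (C : Matrix (Fin 1) (Fin p) ℝ) : Matrix (Fin p) (Fin p) ℝ :=
  Matrix.of fun i j =>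
    ∫ s in Set.Ioi (0 : ℝ), (mexp (-(s • A)) * (B * C) * mexp (-(s • A))) i j

noncomputable def Fmat {p : ℕ} (A : Matrix (Fin p) (Fin p) ℝ) (B : Matrix (Fin p) (Fin 1) ℝ)
    (C : Matrix (Fin 1) (Fin p) ℝ) (x t : ℝ) : Matrix (Fin p) (Fin p) ℝ :=
  mexp ((2 * x) • Aᵀ - (8 * t) • Aᵀ ^ 3) +
    Qmat A C * mexp (-((2 * x) • A) + (8 * t) • A ^ 3) * Nmat A B

noncomputable def Emat {p : ℕ} (A : Matrix (Fin p) (Fin p) ℝ) (B : Matrix (Fin p) (Fin 1) ℝ)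
    (C : Matrix (Fin 1) (Fin p) ℝ) (x t : ℝ) : Matrix (Fin p) (Fin p) ℝ :=
  mexp ((2 * x) • A - (8 * t) • A ^ 3) +
    Pmat A B C * mexp (-((2 * x) • A) + (8 * t) • A ^ 3) * Pmat A B C

noncomputable def uFun {p : ℕ} (A : Matrix (Fin p) (Fin p) ℝ) (B : Matrix (Fin p) (Fin 1) ℝ)
    (C : Matrix (Fin 1) (Fin p) ℝ) (x t : ℝ) : ℝ :=
  -2 * ((Bᵀ * (Fmat A B C x t)⁻¹ * Cᵀ : Matrix (Fin 1) (Fin 1) ℝ) 0 0)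

noncomputable def vFun {p : ℕ} (A : Matrix (Fin p) (Fin p) ℝ) (B : Matrix (Fin p) (Fin 1) ℝ)
    (C : Matrix (Fin 1) (Fin p) ℝ) (x t : ℝ) : ℝ :=
  -2 * ((C * (Emat A B C x t)⁻¹ * B : Matrix (Fin 1) (Fin 1) ℝ) 0 0)

noncomputable def calQ {p : ℕ} (A : Matrix (Fin p) (Fin p) ℝ) (C : Matrix (Fin 1) (Fin p) ℝ)
    (x t : ℝ) : Matrix (Fin p) (Fin p) ℝ :=
  mexp (-(x • Aᵀ)) * mexp ((8 * t) • Aᵀ ^ 3) * Qmat A C * mexp (-(x • A)) * mexp ((8 * t) • A ^ 3)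

noncomputable def calN {p : ℕ} (A : Matrix (Fin p) (Fin p) ℝ) (B : Matrix (Fin p) (Fin 1) ℝ)
    (x : ℝ) : Matrix (Fin p) (Fin p) ℝ :=
  mexp (-(x • A)) * Nmat A B * mexp (-(x • Aᵀ))

noncomputable def Gam {p : ℕ} (A : Matrix (Fin p) (Fin p) ℝ) (B : Matrix (Fin p) (Fin 1) ℝ)
    (C : Matrix (Fin 1) (Fin p) ℝ) (x t : ℝ) : Matrix (Fin p) (Fin p) ℝ :=
  1 + calQ A C x t * calN A B x

noncomputable def Om {p : ℕ} (A : Matrix (Fin p) (Fin p) ℝ) (B : Matrix (Fin p) (Fin 1) ℝ)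
    (C : Matrix (Fin 1) (Fin p) ℝ) (w t : ℝ) : ℝ :=
  ((C * mexp (-(w • A)) * mexp ((8 * t) • A ^ 3) * B : Matrix (Fin 1) (Fin 1) ℝ) 0 0)

noncomputable def Kker {p : ℕ} (A : Matrix (Fin p) (Fin p) ℝ) (B : Matrix (Fin p) (Fin 1) ℝ)
    (C : Matrix (Fin 1) (Fin p) ℝ) (x y t : ℝ) : ℝ :=
  ((Bᵀ * (Fmat A B C x t)⁻¹ * mexp (-((y - x) • Aᵀ)) * Cᵀ : Matrix (Fin 1) (Fin 1) ℝ) 0 0)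

theorem mexp_eq {p : ℕ} (M : Matrix (Fin p) (Fin p) ℝ) : mexp M = NormedSpace.exp M := by
  rw [NormedSpace.exp_eq_tsum ℝ]; rfl

theorem exp_hasSum {p : ℕ} (M : Matrix (Fin p) (Fin p) ℂ) :
    HasSum (fun n : ℕ => ((n.factorial : ℂ)⁻¹) • M ^ n) (NormedSpace.exp M) := by
  open scoped Matrix.Norms.Operator in exact NormedSpace.exp_series_hasSum_exp' (𝕂 := ℂ) M

theorem exp_deriv {p : ℕ} (M : Matrix (Fin p) (Fin p) ℝ) (t : ℝ) (i j : Fin p) :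
    HasDerivAt (fun u : ℝ => NormedSpace.exp (u • M) i j) ((M * NormedSpace.exp (t • M)) i j) t := by
  open scoped Matrix.Norms.Operator in
  have h := hasDerivAt_exp_smul_const' (𝕂 := ℝ) M t
  have := (LinearMap.toContinuousLinearMap (Matrix.entryLinearMap ℝ ℝ i j)).hasFDerivAt.comp_hasDerivAt t h
  exact this

theorem exp_ofReal {p : ℕ} (M : Matrix (Fin p) (Fin p) ℝ) :
    (NormedSpace.exp M).map Complex.ofReal = NormedSpace.exp (M.map Complex.ofReal) := by
  open scoped Matrix.Norms.Operator in
  have := NormedSpace.map_exp (f := (Complex.ofRealHom.mapMatrix : Matrix (Fin p) (Fin p) ℝ →+* Matrix (Fin p) (Fin p) ℂ)) (by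
    show Continuous fun M : Matrix (Fin p) (Fin p) ℝ => M.map Complex.ofReal
    exact continuous_id.matrix_map Complex.continuous_ofReal) M
  exact this

theorem inv_tendsto {p : ℕ} {l : Filter ℝ} (f : ℝ → Matrix (Fin p) (Fin p) ℝ) (h : Tendsto f l (nhds 1)) :
    Tendsto (fun x => (f x)⁻¹) l (nhds 1) ∧ ∀ᶠ x in l, IsUnit (f x).det := by
  have hd : Tendsto (fun x => (f x).det) l (nhds 1) := by
    have := ((continuous_id.matrix_det (n := Fin p) (R := ℝ)).tendsto 1).comp h
    simpa [Function.comp_def] using this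
  constructor
  · simp only [Matrix.inv_def, Ring.inverse_eq_inv']
    have ha : Tendsto (fun x => (f x).adjugate) l (nhds 1) := by
      have := ((continuous_id.matrix_adjugate (n := Fin p) (R := ℝ)).tendsto 1).comp h
      simpa [Function.comp_def] using this
    have := (hd.inv₀ one_ne_zero).smul ha
    simpa using this
  · filter_upwards [hd.eventually_ne one_ne_zero] with x hx using isUnit_iff_ne_zero.2 hx
theorem exp_gen {p : ℕ} (M : Matrix (Fin p) (Fin p) ℂ) (μ : ℂ) (k : ℕ) (v : Fin p → ℂ)
    (hv : (M - μ • 1) ^ k *ᵥ v = 0) (s : ℂ) :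
    NormedSpace.exp (-(s • M)) *ᵥ v = Complex.exp (-(s * μ)) •
      ∑ j ∈ Finset.range k, ((j.factorial : ℂ)⁻¹ * (-s) ^ j) • ((M - μ • 1) ^ j *ᵥ v) := by
  set D := M - μ • 1 with hD
  have h1 : -(s • M) = (-(s * μ)) • (1 : Matrix (Fin p) (Fin p) ℂ) + (-s) • D := by
    rw [hD, smul_sub, smul_smul, neg_smul, neg_smul, neg_mul, neg_smul]; abel
  have h2 : NormedSpace.exp ((-(s * μ)) • (1 : Matrix (Fin p) (Fin p) ℂ)) =
      Complex.exp (-(s * μ)) • 1 := by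
    rw [Matrix.smul_one_eq_diagonal, Matrix.exp_diagonal, Matrix.smul_one_eq_diagonal]
    congr 1
    ext i
    rw [Pi.coe_exp, Complex.exp_eq_exp_ℂ]
  rw [h1, Matrix.exp_add_of_commute _ _ ((Commute.one_left _).smul_left _), h2, smul_mul_assoc,
    one_mul, Matrix.smul_mulVec]
  congr 1
  have h3 := exp_hasSum ((-s) • D)
  have h4 : HasSum (fun n : ℕ => (((n.factorial : ℂ)⁻¹) • ((-s) • D) ^ n) *ᵥ v)
      (NormedSpace.exp ((-s) • D) *ᵥ v) := by
    exact h3.map (⟨⟨fun X : Matrix (Fin p) (Fin p) ℂ => X *ᵥ v, by simp⟩,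
      fun x y => Matrix.add_mulVec x y v⟩ : Matrix (Fin p) (Fin p) ℂ →+ (Fin p → ℂ))
      (continuous_id.matrix_mulVec continuous_const)
  refine h4.unique ?_
  have h5 : (fun n : ℕ => (((n.factorial : ℂ)⁻¹) • ((-s) • D) ^ n) *ᵥ v) =
      fun n => ((n.factorial : ℂ)⁻¹ * (-s) ^ n) • (D ^ n *ᵥ v) := by
    ext1 n
    rw [smul_pow, smul_smul, Matrix.smul_mulVec]
  rw [h5]
  refine hasSum_sum_of_ne_finset_zero fun n hn => ?_
  have hn : k ≤ n := by simpa using hn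
  have h6 : D ^ n *ᵥ v = 0 := by
    rw [← Nat.sub_add_cancel hn, pow_add, ← Matrix.mulVec_mulVec, hv, Matrix.mulVec_zero]
  rw [h6, smul_zero]

open Asymptotics Topology in
theorem decay_vec {p : ℕ} (M : Matrix (Fin p) (Fin p) ℂ) (hM : ∀ μ ∈ spectrum ℂ M, 0 < μ.re)
    (v : Fin p → ℂ) : ∀ᶠ c in 𝓝[>] (0 : ℝ), ∀ i,
      (fun s : ℝ => (NormedSpace.exp (-((s : ℂ) • M)) *ᵥ v) i) =O[atTop]
        fun s : ℝ => Real.exp (-c * s) := by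
  have hv : v ∈ ⨆ μ, Module.End.maxGenEigenspace (Matrix.toLin' M) μ := by
    rw [Module.End.iSup_maxGenEigenspace_eq_top]; trivial
  refine Submodule.iSup_induction _ (motive := fun v => ∀ᶠ c in 𝓝[>] (0 : ℝ), ∀ i,
      (fun s : ℝ => (NormedSpace.exp (-((s : ℂ) • M)) *ᵥ v) i) =O[atTop]
        fun s : ℝ => Real.exp (-c * s)) hv ?_ ?_ ?_
  · intro μ v hv
    obtain ⟨k, hk⟩ := (Module.End.mem_maxGenEigenspace _ _ _).1 hv
    have hk' : (M - μ • 1) ^ k *ᵥ v = 0 := by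
      have : (Matrix.toLin' M - μ • 1) ^ k = Matrix.toLin' ((M - μ • 1) ^ k) := by
        rw [Matrix.toLin'_pow, map_sub, map_smul, Matrix.toLin'_one]; rfl
      rw [this] at hk
      exact hk
    by_cases hμ : μ ∈ spectrum ℂ M
    · filter_upwards [Ioo_mem_nhdsGT (hM μ hμ)] with c hc i
      simp_rw [exp_gen M μ k v hk']
      simp only [Pi.smul_apply, Finset.sum_apply, smul_eq_mul, Finset.mul_sum]
      refine IsBigO.fun_sum fun j _ => ?_
      have hlt : 0 < μ.re - c := by linarith [hc.2]
      have h1 := (isLittleO_pow_exp_pos_mul_atTop j hlt).isBigO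
      have h2 : (fun s : ℝ => Real.exp (-(s * μ.re)) * s ^ j) =O[atTop]
          fun s : ℝ => Real.exp (-(s * μ.re)) * Real.exp ((μ.re - c) * s) :=
        (isBigO_refl _ _).mul h1
      have h3 : (fun s : ℝ => Real.exp (-(s * μ.re)) * Real.exp ((μ.re - c) * s)) =
          fun s => Real.exp (-c * s) := by
        ext s; rw [← Real.exp_add]; congr 1; ring
      rw [h3] at h2
      refine IsBigO.trans ?_ h2
      refine IsBigO.of_bound (‖(j.factorial : ℂ)⁻¹‖ * ‖((M - μ • 1) ^ j *ᵥ v) i‖)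
        (Eventually.of_forall fun s => le_of_eq ?_)
      simp only [norm_mul, norm_pow, norm_neg, Complex.norm_exp, Complex.norm_real,
        Real.norm_eq_abs, Real.abs_exp]
      simp
      ring
    · have hu : IsUnit (M - μ • 1) := by
        have := spectrum.notMem_iff.1 hμ
        rw [← neg_sub, Algebra.algebraMap_eq_smul_one] at this
        simpa using this.neg
      have hv0 : v = 0 := by
        have := Matrix.mulVec_injective_iff_isUnit.2 (hu.pow k)
        apply this
        simpa using hk'
      simp [hv0, isBigO_zero]
  · simp [isBigO_zero]
  · intro x y hx hy
    filter_upwards [hx, hy] with c h1 h2 i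
    simpa [Matrix.mulVec_add] using (h1 i).add (h2 i)

open Asymptotics Topology in
def Dec {p : ℕ} (A : Matrix (Fin p) (Fin p) ℝ) : Prop :=
  ∃ c > 0, ∀ i j, (fun s : ℝ => NormedSpace.exp (-(s • A)) i j) =O[atTop]
    fun s : ℝ => Real.exp (-c * s)

open Asymptotics Topology in
theorem dec_of_eig {p : ℕ} (A : Matrix (Fin p) (Fin p) ℝ) (hA : EigPos A) : Dec A := by
  have h := fun j : Fin p => decay_vec (A.map Complex.ofReal) hA (Pi.single j 1)
  have h := (Filter.eventually_all.2 h).and self_mem_nhdsWithin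
  obtain ⟨c, hc, hc0⟩ := h.exists
  refine ⟨c, hc0, fun i j => ?_⟩
  have := hc j i
  refine (IsBigO.congr_left this.norm_left ?_).of_norm_left
  intro s
  have h1 : -((s : ℂ) • A.map Complex.ofReal) = (-(s • A)).map Complex.ofReal := by
    ext; simp
  simp only [h1, ← exp_ofReal]
  simp

theorem Dec.transpose {p : ℕ} {A : Matrix (Fin p) (Fin p) ℝ} (h : Dec A) : Dec Aᵀ := by
  obtain ⟨c, hc, h⟩ := h
  refine ⟨c, hc, fun i j => ?_⟩
  have h1 : ∀ s : ℝ, -(s • Aᵀ) = (-(s • A))ᵀ := fun s => by simp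
  simp_rw [h1, Matrix.exp_transpose]
  exact h j i
theorem exp_cont {p : ℕ} (A : Matrix (Fin p) (Fin p) ℝ) (i j : Fin p) :
    Continuous fun s : ℝ => NormedSpace.exp (-(s • A)) i j := by
  have h : ∀ s : ℝ, -(s • A) = s • (-A) := fun s => by simp
  simp_rw [h]
  exact continuous_iff_continuousAt.2 fun s => (exp_deriv (-A) s i j).continuousAt

theorem row_deriv {p : ℕ} (A : Matrix (Fin p) (Fin p) ℝ) (R : Matrix (Fin 1) (Fin p) ℝ)
    (v : Fin p → ℝ) (s : ℝ) :
    HasDerivAt (fun s : ℝ => ((R * NormedSpace.exp (-(s • A))) *ᵥ v) 0)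
      (-(((R * A) * NormedSpace.exp (-(s • A))) *ᵥ v) 0) s := by
  have h : ∀ s : ℝ, -(s • A) = s • (-A) := fun s => by simp
  simp_rw [h]
  have h2 : -(((R * A) * NormedSpace.exp (s • (-A))) *ᵥ v) 0 =
      ((R * ((-A) * NormedSpace.exp (s • (-A)))) *ᵥ v) 0 := by
    simp [Matrix.mul_assoc, Matrix.neg_mulVec]
  rw [h2]
  simp only [Matrix.mulVec, dotProduct, Matrix.mul_apply (M := R)]
  refine HasDerivAt.fun_sum fun i _ => HasDerivAt.mul_const ?_ _
  exact HasDerivAt.fun_sum fun j _ => HasDerivAt.const_mul _ (exp_deriv (-A) s j i)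

theorem obs_zero {p : ℕ} (A : Matrix (Fin p) (Fin p) ℝ) (C : Matrix (Fin 1) (Fin p) ℝ)
    (hobs : Observable A C) (v : Fin p → ℝ)
    (h : ∀ s : ℝ, 0 < s → ((C * NormedSpace.exp (-(s • A))) *ᵥ v) 0 = 0) : v = 0 := by
  have key : ∀ r : ℕ, ∀ s : ℝ, 0 < s → ((C * A ^ r * NormedSpace.exp (-(s • A))) *ᵥ v) 0 = 0 := by
    intro r
    induction r with
    | zero => simpa using h
    | succ r ih =>
      intro s hs
      have h1 := row_deriv A (C * A ^ r) v s
      have h2 : HasDerivAt (fun s : ℝ => ((C * A ^ r * NormedSpace.exp (-(s • A))) *ᵥ v) 0) 0 s := by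
        refine (hasDerivAt_const s (0 : ℝ)).congr_of_eventuallyEq ?_
        filter_upwards [lt_mem_nhds hs] with x hx using ih x hx
      have h3 := h1.unique h2
      rw [pow_succ, ← Matrix.mul_assoc]
      linarith
  have hw : NormedSpace.exp (-((1 : ℝ) • A)) *ᵥ v = 0 := by
    apply hobs
    intro r
    ext i
    rw [Subsingleton.elim i 0, Matrix.mulVec_mulVec]
    exact key r 1 one_pos
  have hu := Matrix.mulVec_injective_iff_isUnit.2 (Matrix.isUnit_exp (-((1 : ℝ) • A)))
  apply hu
  simpa using hw

open Asymptotics Topology in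
theorem Q_unit {p : ℕ} (A : Matrix (Fin p) (Fin p) ℝ) (C : Matrix (Fin 1) (Fin p) ℝ)
    (hd : Dec A) (hobs : Observable A C) : IsUnit (Qmat A C).det := by
  obtain ⟨c, hc, hd⟩ := hd
  set g : ℝ → Fin p → ℝ := fun s i => (C * NormedSpace.exp (-(s • A))) 0 i with hg
  have hgc : ∀ i, Continuous fun s => g s i := by
    intro i
    simp only [hg, Matrix.mul_apply]
    exact continuous_finsetSum _ fun j _ => continuous_const.mul (exp_cont A j i)
  have hgO : ∀ i, (fun s => g s i) =O[atTop] fun s : ℝ => Real.exp (-c * s) := by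
    intro i
    simp only [hg, Matrix.mul_apply]
    exact IsBigO.fun_sum fun j _ => (hd j i).const_mul_left _
  have hint : ∀ i j, IntegrableOn (fun s => g s i * g s j) (Set.Ioi 0) volume := by
    intro i j
    refine integrable_of_isBigO_exp_neg (b := 2 * c) (by positivity)
      ((hgc i).mul (hgc j)).continuousOn ?_
    refine ((hgO i).mul (hgO j)).congr_right fun s => ?_
    rw [← Real.exp_add]; congr 1; ring
  have hQ : ∀ i j, Qmat A C i j = ∫ s in Set.Ioi (0 : ℝ), g s i * g s j := by
    intro i j
    simp only [Qmat, Matrix.of_apply, mexp_eq]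
    congr 1
    ext s
    have h1 : -(s • Aᵀ) = (-(s • A))ᵀ := by simp
    rw [h1, Matrix.exp_transpose, ← Matrix.mul_assoc, ← Matrix.transpose_mul, Matrix.mul_assoc,
      Matrix.mul_apply]
    simp [hg]
  rw [isUnit_iff_ne_zero]
  intro hdet
  obtain ⟨v, hv, hv0⟩ := Matrix.exists_mulVec_eq_zero_iff.2 hdet
  apply hv
  have h1 : ∫ s in Set.Ioi (0 : ℝ), (∑ i, g s i * v i) ^ 2 = 0 := by
    have h2 : v ⬝ᵥ (Qmat A C *ᵥ v) = 0 := by rw [hv0]; simp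
    refine Eq.trans ?_ h2
    have h3 : ∀ s, (∑ i, g s i * v i) ^ 2 = ∑ i, ∑ j, v i * (g s i * g s j * v j) := by
      intro s
      rw [sq, Finset.sum_mul_sum]
      refine Finset.sum_congr rfl fun i _ => Finset.sum_congr rfl fun j _ => by ring
    simp_rw [h3]
    rw [integral_finsetSum _ fun i _ => integrable_finsetSum _ fun j _ =>
      ((hint i j).mul_const _).const_mul _]
    simp only [dotProduct, Matrix.mulVec, hQ, Finset.mul_sum]
    refine Finset.sum_congr rfl fun i _ => ?_
    rw [integral_finsetSum _ fun j _ => ((hint i j).mul_const _).const_mul _]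
    refine Finset.sum_congr rfl fun j _ => ?_
    rw [integral_const_mul, integral_mul_const]
  have hcont : Continuous fun s => (∑ i, g s i * v i) ^ 2 :=
    (continuous_finsetSum _ fun i _ => (hgc i).mul continuous_const).pow 2
  have hI : IntegrableOn (fun s => (∑ i, g s i * v i) ^ 2) (Set.Ioi 0) volume := by
    refine integrable_of_isBigO_exp_neg (b := 2 * c) (by positivity) hcont.continuousOn ?_
    have : (fun s => ∑ i, g s i * v i) =O[atTop] fun s : ℝ => Real.exp (-c * s) :=
      IsBigO.fun_sum fun i _ => by
        exact ((hgO i).const_mul_left (v i)).congr_left fun s => mul_comm _ _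
    refine (this.pow 2).congr_right fun s => ?_
    rw [← Real.exp_nat_mul]; congr 1; push_cast; ring
  have h4 := (setIntegral_eq_zero_iff_of_nonneg_ae
    (Eventually.of_forall fun s => sq_nonneg _) hI).1 h1
  have h5 := MeasureTheory.Measure.eqOn_of_ae_eq h4 hcont.continuousOn continuousOn_const
    (by rw [interior_Ioi]; exact subset_closure)
  refine obs_zero A C hobs v fun s hs => ?_
  have := h5 (Set.mem_Ioi.2 hs)
  exact pow_eq_zero_iff two_ne_zero |>.1 this

theorem dec_tendsto {p : ℕ} {A : Matrix (Fin p) (Fin p) ℝ} (h : Dec A) :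
    Tendsto (fun s : ℝ => NormedSpace.exp (-(s • A))) atTop (nhds 0) := by
  obtain ⟨c, hc, h⟩ := h
  refine tendsto_pi_nhds.2 fun i => tendsto_pi_nhds.2 fun j => ?_
  refine (h i j).trans_tendsto ?_
  refine Real.tendsto_exp_atBot.comp ?_
  exact tendsto_id.const_mul_atTop_of_neg (by linarith)

theorem exp_neg_mul {p : ℕ} (M : Matrix (Fin p) (Fin p) ℝ) :
    NormedSpace.exp M * NormedSpace.exp (-M) = 1 := by
  rw [← Matrix.exp_add_of_commute _ _ (Commute.refl M).neg_right]; simp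

theorem G_tendsto {p : ℕ} {A : Matrix (Fin p) (Fin p) ℝ} (h : Dec A) (t : ℝ) :
    Tendsto (fun x : ℝ => NormedSpace.exp (-((2 * x) • A - (8 * t) • A ^ 3))) atTop (nhds 0) := by
  have h1 : ∀ x : ℝ, NormedSpace.exp (-((2 * x) • A - (8 * t) • A ^ 3)) =
      NormedSpace.exp (-((2 * x) • A)) * NormedSpace.exp ((8 * t) • A ^ 3) := by
    intro x
    rw [← Matrix.exp_add_of_commute]
    · congr 1; abel
    · exact (((Commute.refl A).pow_right 3).smul_left _ |>.smul_right _).neg_left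
  simp_rw [h1]
  have h2 := (dec_tendsto h).comp (tendsto_id.const_mul_atTop (two_pos : (0 : ℝ) < 2))
  simpa using h2.mul_const (NormedSpace.exp ((8 * t) • A ^ 3))

theorem G_tendsto' {p : ℕ} {A : Matrix (Fin p) (Fin p) ℝ} (h : Dec A) (t : ℝ) :
    Tendsto (fun x : ℝ => NormedSpace.exp ((2 * x) • A - (8 * t) • A ^ 3)) atBot (nhds 0) := by
  have := (G_tendsto h (-t)).comp tendsto_neg_atBot_atTop
  refine this.congr fun x => ?_
  simp only [Function.comp]
  congr 1
  simp only [mul_neg, neg_smul]; abel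

/- abstract algebra: F = Gt + Q * Gi * N -/
theorem lim_top {p : ℕ} {l : Filter ℝ} (Gt Gti Gi : ℝ → Matrix (Fin p) (Fin p) ℝ)
    (Q N : Matrix (Fin p) (Fin p) ℝ)
    (h1 : ∀ x, Gt x * Gti x = 1) (h2 : Tendsto Gti l (nhds 0)) (h3 : Tendsto Gi l (nhds 0)) :
    Tendsto (fun x => (Gt x + Q * Gi x * N)⁻¹) l (nhds 0) := by
  have h4 : Tendsto (fun x => 1 + Gti x * (Q * Gi x * N)) l (nhds 1) := by
    simpa using (h2.mul ((h3.const_mul Q).mul_const N)).const_add 1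
  have h5 := (inv_tendsto _ h4).1.mul h2
  rw [mul_zero] at h5
  refine h5.congr fun x => ?_
  have h6 : Gt x + Q * Gi x * N = Gt x * (1 + Gti x * (Q * Gi x * N)) := by
    rw [mul_add, ← mul_assoc (Gt x) (Gti x), h1, mul_one, one_mul]
  rw [h6, Matrix.mul_inv_rev, Matrix.inv_eq_right_inv (h1 x)]

theorem lim_bot {p : ℕ} {l : Filter ℝ} (Gt G Gi : ℝ → Matrix (Fin p) (Fin p) ℝ)
    (Q N : Matrix (Fin p) (Fin p) ℝ) (hQ : IsUnit Q.det) (hN : IsUnit N.det)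
    (h1 : ∀ x, Gi x * G x = 1) (h2 : Tendsto G l (nhds 0)) (h3 : Tendsto Gt l (nhds 0)) :
    Tendsto (fun x => (Gt x + Q * Gi x * N)⁻¹) l (nhds 0) := by
  have h4 := lim_top (fun x => Q * Gi x * N) (fun x => N⁻¹ * G x * Q⁻¹) Gt 1 1 (fun x => by
      calc Q * Gi x * N * (N⁻¹ * G x * Q⁻¹) = Q * (Gi x * (N * N⁻¹) * G x) * Q⁻¹ := by
            simp only [mul_assoc]
        _ = 1 := by rw [Matrix.mul_nonsing_inv _ hN, mul_one, h1, mul_one,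
                      Matrix.mul_nonsing_inv _ hQ])
    (by simpa using (h2.const_mul N⁻¹).mul_const Q⁻¹) h3
  refine h4.congr fun x => ?_
  rw [one_mul, mul_one, add_comm]

theorem statement3 {p : ℕ} (hp : 0 < p) (A : Matrix (Fin p) (Fin p) ℝ)
    (B : Matrix (Fin p) (Fin 1) ℝ) (C : Matrix (Fin 1) (Fin p) ℝ)
    (hA : EigPos A) (hobs : Observable A C) (hctrl : Controllable A B) :
    ∀ t : ℝ,
      Tendsto (fun x : ℝ => (Fmat A B C x t)⁻¹) atTop
        (nhds (0 : Matrix (Fin p) (Fin p) ℝ)) ∧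
      Tendsto (fun x : ℝ => (Fmat A B C x t)⁻¹) atBot
        (nhds (0 : Matrix (Fin p) (Fin p) ℝ)) := by
  intro t
  have hd := dec_of_eig A hA
  have hdt := hd.transpose
  have hQ := Q_unit A C hd hobs
  have hN : IsUnit (Nmat A B).det := Q_unit Aᵀ Bᵀ hdt hctrl
  have e : ∀ x : ℝ, -((2 * x) • A) + (8 * t) • A ^ 3 = -((2 * x) • A - (8 * t) • A ^ 3) := by
    intro x; abel
  simp only [Fmat, mexp_eq, e]
  constructor
  · exact lim_top _ _ _ _ _ (fun x => exp_neg_mul _) (G_tendsto hdt t) (G_tendsto hd t)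
  · refine lim_bot _ (fun x => NormedSpace.exp ((2 * x) • A - (8 * t) • A ^ 3)) _ _ _ hQ hN
      (fun x => ?_) (G_tendsto' hd t) (G_tendsto' hdt t)
    have := exp_neg_mul (-((2 * x) • A - (8 * t) • A ^ 3))
    rwa [neg_neg] at this
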